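/- Let G and H be groups such that the direct product G × H is skew-free, i.e., every normal subgroup of G × H is of the form N₁ × N₂ for some normal subgroups N₁ of G and N₂ of H. Then the clone Comp(G × H) of congruence preserving functions of G × H is finitely generated if and only if both Comp(G) and Comp(H) are finitely generated. -/

import Mathlib

/-- A finitary operation on `A`. -/
abbrev FinOp (A : Type*) := Σ n : ℕ, (Fin n → A) → A

/-- Membership in the clone generated by a set `F` of finitary operations:
the smallest set of finitary operations containing `F` and all projections
and closed under composition. -/
inductive InClone {A : Type*} (F : Set (FinOp A)) : {n : ℕ} → ((Fin n → A) → A) → Prop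
  | proj {n : ℕ} (i : Fin n) : InClone F fun x => x i
  | base {n : ℕ} (f : (Fin n → A) → A) : (⟨n, f⟩ : FinOp A) ∈ F → InClone F f
  | comp {n m : ℕ} (f : (Fin m → A) → A) (g : Fin m → (Fin n → A) → A) :
      InClone F f → (∀ i, InClone F (g i)) → InClone F fun x => f fun i => g i x

/-- A function `G^k → G` is compatible (congruence preserving): it preserves
every congruence, i.e. for every normal subgroup `N` and tuples `a ≡ b mod N`
one has `f a ≡ f b mod N`. -/
def Compatible {G : Type*} [Group G] {k : ℕ} (f : (Fin k → G) → G) : Prop :=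
  ∀ N : Subgroup G, N.Normal → ∀ a b : Fin k → G,
    (∀ i, (a i)⁻¹ * b i ∈ N) → (f a)⁻¹ * f b ∈ N

/-- The clone `Comp G` of congruence preserving functions of `G` is finitely
generated: some finite set of compatible functions generates, as a clone,
exactly the compatible functions (of all arities `≥ 1`). -/
def CompFG (G : Type*) [Group G] : Prop :=
  ∃ F : Set (FinOp G), F.Finite ∧ (∀ f ∈ F, 1 ≤ f.1 ∧ Compatible f.2) ∧
    ∀ (n : ℕ), 1 ≤ n → ∀ f : (Fin n → G) → G, (Compatible f ↔ InClone F f)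

/-- The operation `h` on `A` induces the operation `f` on `B` along the map `π : A → B`. -/
def Induces {A B : Type*} (π : A → B) {n : ℕ} (h : (Fin n → A) → A) (f : (Fin n → B) → B) : Prop :=
  ∀ x, π (h x) = f fun i => π (x i)

theorem InClone.exists_induced {A B : Type*} {π : A → B} {F : Set (FinOp A)} {F' : Set (FinOp B)}
    (hF : ∀ p ∈ F, ∃ f : (Fin p.1 → B) → B, InClone F' f ∧ Induces π p.2 f)
    {n : ℕ} {h : (Fin n → A) → A} (hh : InClone F h) :
    ∃ f : (Fin n → B) → B, InClone F' f ∧ Induces π h f := by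
  induction hh with
  | proj i => exact ⟨_, .proj i, fun _ => rfl⟩
  | base h hh => exact hF _ hh
  | comp h k _ _ ihh ihk =>
    obtain ⟨f, hf, hfh⟩ := ihh
    choose g hg hgk using ihk
    refine ⟨_, .comp f g hf hg, fun x => ?_⟩
    rw [hfh]
    exact congrArg f (funext fun i => hgk i x)

theorem InClone.exists_inducing {A B : Type*} {π : A → B} {F : Set (FinOp A)} {F' : Set (FinOp B)}
    (hF : ∀ p ∈ F', ∃ h : (Fin p.1 → A) → A, InClone F h ∧ Induces π h p.2)
    {n : ℕ} {f : (Fin n → B) → B} (hf : InClone F' f) :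
    ∃ h : (Fin n → A) → A, InClone F h ∧ Induces π h f := by
  induction hf with
  | proj i => exact ⟨_, .proj i, fun _ => rfl⟩
  | base f hf => exact hF _ hf
  | comp f g _ _ ihf ihg =>
    obtain ⟨h, hh, hhf⟩ := ihf
    choose k hk hkg using ihg
    refine ⟨_, .comp h k hh hk, fun x => ?_⟩
    rw [hhf]
    exact congrArg f (funext fun i => hkg i x)

theorem Compatible.proj {A : Type*} [Group A] {n : ℕ} (i : Fin n) :
    Compatible fun x : Fin n → A => x i :=
  fun _ _ _ _ hab => hab i

theorem InClone.compatible {A : Type*} [Group A] {F : Set (FinOp A)}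
    (hF : ∀ p ∈ F, Compatible p.2) {n : ℕ} {f : (Fin n → A) → A} (hf : InClone F f) :
    Compatible f := by
  induction hf with
  | proj i => exact .proj i
  | base f hf => exact hF _ hf
  | comp f g _ _ ihf ihg =>
    exact fun N hN a b hab => ihf N hN _ _ fun i => ihg i N hN a b hab

/-- A compatible operation induces a compatible operation on every homomorphic image. -/
theorem Compatible.exists_induced {A B : Type*} [Group A] [Group B] {π : A →* B}
    (hπ : Function.Surjective π) {n : ℕ} {h : (Fin n → A) → A} (hh : Compatible h) :
    ∃ f : (Fin n → B) → B, Compatible f ∧ Induces π h f := by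
  refine ⟨fun x => π (h fun i => Function.surjInv hπ (x i)), fun N hN a b hab => ?_, fun x => ?_⟩
  · have := hh (N.comap π) (hN.comap π) (fun i => Function.surjInv hπ (a i))
      (fun i => Function.surjInv hπ (b i)) fun i => by
        simpa [Subgroup.mem_comap, Function.surjInv_eq hπ] using hab i
    simpa [Subgroup.mem_comap] using this
  · have := hh π.ker π.normal_ker x (fun i => Function.surjInv hπ (π (x i))) fun i => by
      simp [MonoidHom.mem_ker, Function.surjInv_eq hπ]
    simpa [MonoidHom.mem_ker, inv_mul_eq_one] using this

/-- If all compatible operations lift along the surjective homomorphism `π`, finite generation of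
the clone of compatible operations passes to the image of `π`. -/
theorem CompFG.of_surjective {A B : Type*} [Group A] [Group B] {π : A →* B}
    (hπ : Function.Surjective π)
    (hlift : ∀ n : ℕ, 1 ≤ n → ∀ f : (Fin n → B) → B, Compatible f →
      ∃ h : (Fin n → A) → A, Compatible h ∧ Induces π h f)
    (hA : CompFG A) : CompFG B := by
  obtain ⟨F, hfin, hF, hgen⟩ := hA
  choose φ hφ hφπ using fun p : F => (hF p p.2).2.exists_induced hπ
  have := hfin.to_subtype
  have hcompat : ∀ q ∈ Set.range fun p : F => (⟨p.1.1, φ p⟩ : FinOp B),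
      1 ≤ q.1 ∧ Compatible q.2 := by
    rintro _ ⟨p, rfl⟩
    exact ⟨(hF p p.2).1, hφ p⟩
  refine ⟨_, Set.finite_range _, hcompat, fun n hn f =>
    ⟨fun hf => ?_, InClone.compatible fun q hq => (hcompat q hq).2⟩⟩
  obtain ⟨h, hh, hhf⟩ := hlift n hn f hf
  obtain ⟨g, hg, hhg⟩ := ((hgen n hn h).1 hh).exists_induced
    (π := π) (F' := Set.range fun p : F => (⟨p.1.1, φ p⟩ : FinOp B)) fun p hp =>
    ⟨φ ⟨p, hp⟩, .base _ ⟨⟨p, hp⟩, rfl⟩, hφπ ⟨p, hp⟩⟩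
  have hfg : f = g := by
    funext x
    obtain ⟨y, rfl⟩ := hπ.comp_left x
    exact (hhf y).symm.trans (hhg y)
  exact hfg ▸ hg

/-- The componentwise operation on a product. -/
def prodOp {A B : Type*} {n : ℕ} (f : (Fin n → A) → A) (g : (Fin n → B) → B) :
    (Fin n → A × B) → A × B :=
  fun x => (f fun i => (x i).1, g fun i => (x i).2)

theorem Compatible.prodOp {G H : Type*} [Group G] [Group H]
    (hskew : ∀ K : Subgroup (G × H), K.Normal →
      ∃ (N₁ : Subgroup G) (N₂ : Subgroup H), N₁.Normal ∧ N₂.Normal ∧ K = N₁.prod N₂)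
    {n : ℕ} {f : (Fin n → G) → G} {g : (Fin n → H) → H} (hf : Compatible f) (hg : Compatible g) :
    Compatible (prodOp f g) := by
  intro K hK a b hab
  obtain ⟨N₁, N₂, h₁, h₂, rfl⟩ := hskew K hK
  exact ⟨hf N₁ h₁ _ _ fun i => (hab i).1, hg N₂ h₂ _ _ fun i => (hab i).2⟩

theorem CompFG.prod {G H : Type*} [Group G] [Group H]
    (hskew : ∀ K : Subgroup (G × H), K.Normal →
      ∃ (N₁ : Subgroup G) (N₂ : Subgroup H), N₁.Normal ∧ N₂.Normal ∧ K = N₁.prod N₂)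
    (hG : CompFG G) (hH : CompFG H) : CompFG (G × H) := by
  obtain ⟨F₁, hfin₁, hF₁, hgen₁⟩ := hG
  obtain ⟨F₂, hfin₂, hF₂, hgen₂⟩ := hH
  have := hfin₁.to_subtype
  have := hfin₂.to_subtype
  let L₁ : F₁ → FinOp (G × H) := fun p =>
    ⟨p.1.1, prodOp p.1.2 fun x => x ⟨0, (hF₁ p p.2).1⟩⟩
  let L₂ : F₂ → FinOp (G × H) := fun p =>
    ⟨p.1.1, prodOp (fun x => x ⟨0, (hF₂ p p.2).1⟩) p.1.2⟩
  let mix : (Fin 2 → G × H) → G × H := prodOp (fun x => x 0) (fun x => x 1)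
  let F : Set (FinOp (G × H)) := insert ⟨2, mix⟩ (Set.range L₁ ∪ Set.range L₂)
  have hF : ∀ q ∈ F, 1 ≤ q.1 ∧ Compatible q.2 := by
    rintro _ (rfl | ⟨p, rfl⟩ | ⟨p, rfl⟩)
    · exact ⟨one_le_two, .prodOp hskew (.proj 0) (.proj 1)⟩
    · exact ⟨(hF₁ p p.2).1, .prodOp hskew (hF₁ p p.2).2 (.proj _)⟩
    · exact ⟨(hF₂ p p.2).1, .prodOp hskew (.proj _) (hF₂ p p.2).2⟩
  refine ⟨F, ((Set.finite_range L₁).union (Set.finite_range L₂)).insert _, hF, fun n hn f =>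
    ⟨fun hf => ?_, InClone.compatible fun q hq => (hF q hq).2⟩⟩
  obtain ⟨f₁, hf₁, hff₁⟩ := hf.exists_induced (π := MonoidHom.fst G H) Prod.fst_surjective
  obtain ⟨f₂, hf₂, hff₂⟩ := hf.exists_induced (π := MonoidHom.snd G H) Prod.snd_surjective
  obtain ⟨h₁, hh₁, hhf₁⟩ := ((hgen₁ n hn f₁).1 hf₁).exists_inducing (F := F)
    (π := MonoidHom.fst G H) fun p hp =>
      ⟨_, .base _ (.inr (.inl ⟨⟨p, hp⟩, rfl⟩)), fun _ => rfl⟩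
  obtain ⟨h₂, hh₂, hhf₂⟩ := ((hgen₂ n hn f₂).1 hf₂).exists_inducing (F := F)
    (π := MonoidHom.snd G H) fun p hp =>
      ⟨_, .base _ (.inr (.inr ⟨⟨p, hp⟩, rfl⟩)), fun _ => rfl⟩
  have hmix : f = fun x => mix fun i => ![h₁, h₂] i x := by
    funext x
    exact Prod.ext ((hff₁ x).trans (hhf₁ x).symm) ((hff₂ x).trans (hhf₂ x).symm)
  rw [hmix]
  exact .comp mix ![h₁, h₂] (.base _ (.inl rfl)) (Fin.forall_fin_two.2 ⟨hh₁, hh₂⟩)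

/-- Proposition (instance for groups): if the direct product `G × H` is
skew-free, then `Comp (G × H)` is finitely generated iff both `Comp G` and
`Comp H` are finitely generated. -/
theorem compFG_prod_iff (G H : Type*) [Group G] [Group H]
    (hskew : ∀ K : Subgroup (G × H), K.Normal →
      ∃ (N₁ : Subgroup G) (N₂ : Subgroup H), N₁.Normal ∧ N₂.Normal ∧ K = N₁.prod N₂) :
    CompFG (G × H) ↔ (CompFG G ∧ CompFG H) := by
  refine ⟨fun h => ⟨?_, ?_⟩, fun h => h.1.prod hskew h.2⟩
  · exact h.of_surjective (π := MonoidHom.fst G H) Prod.fst_surjective fun n hn f hf =>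
      ⟨prodOp f fun x => x ⟨0, hn⟩, .prodOp hskew hf (.proj _), fun _ => rfl⟩
  · exact h.of_surjective (π := MonoidHom.snd G H) Prod.snd_surjective fun n hn f hf =>
      ⟨prodOp (fun x => x ⟨0, hn⟩) f, .prodOp hskew (.proj _) hf, fun _ => rfl⟩
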